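/- For q > 1 and integers 0 ≤ m ≤ l, the big q-Jacobi polynomials satisfy the q-difference equation (q^{−1−2m}(q^{2l+1} + q^{−2l−1})x² − q^{−4(m+1)}(q²+1))·P^m_l(x) = q^{−2(2m+1)}(x² − 1)·P^m_l(xq⁻²) + (x² − q^{−4(m+1)})·P^m_l(xq²) as an identity of polynomials in x. -/

import Mathlib

noncomputable section

/-- Symmetric q-number [a] = (q^a − q^{−a})/(q − q⁻¹). -/
def qNum (q : ℝ) (a : ℤ) : ℝ := (q ^ a - q ^ (-a)) / (q - q⁻¹)

/-- Symmetric q-factorial [n]! = ∏_{k=1}^n [k]. -/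
def qFact (q : ℝ) (n : ℕ) : ℝ := ∏ k ∈ Finset.range n, qNum q (k + 1)

/-- Symmetric q-binomial coefficient, zero unless 0 ≤ k ≤ n. -/
def qBinom (q : ℝ) (n k : ℤ) : ℝ :=
  if 0 ≤ k ∧ k ≤ n then qFact q n.toNat / (qFact q k.toNat * qFact q (n - k).toNat)
  else 0

/-- q-Pochhammer symbol (a;p)_k = ∏_{n=0}^{k−1}(1 − a p^n). -/
def qPoch (a p : ℝ) (k : ℕ) : ℝ := ∏ n ∈ Finset.range k, (1 - a * p ^ n)

/-- (x;p)_k as a polynomial in x. -/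
def qPochPoly (p : ℝ) (k : ℕ) : Polynomial ℝ :=
  ∏ n ∈ Finset.range k, (1 - Polynomial.C (p ^ n) * Polynomial.X)

/-- The big q-Jacobi polynomial
P^m_l(x) = Σ_{k=0}^{l−m} (−1)^k q^{−k(m+1)} (x;q⁻²)_k/(−q^{−2(m+1)};q⁻²)_k
  [l−m choose k][l+m+k choose k][m+k choose k]⁻¹.
(It vanishes identically for l < m, since then [l−m choose k] = 0.) -/
def qJacobi (q : ℝ) (l m : ℕ) : Polynomial ℝ :=
  ∑ k ∈ Finset.range (l - m + 1),
    Polynomial.C ((-1 : ℝ) ^ k * q ^ (-(k : ℤ) * ((m : ℤ) + 1)) /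
        qPoch (-(q ^ (-2 * ((m : ℤ) + 1)))) (q ^ (-2 : ℤ)) k *
      (qBinom q ((l : ℤ) - (m : ℤ)) k * qBinom q ((l : ℤ) + (m : ℤ) + k) k /
        qBinom q ((m : ℤ) + k) k)) *
    qPochPoly (q ^ (-2 : ℤ)) k

theorem qNum_ne_zero {q : ℝ} (hq : 1 < q) {a : ℤ} (ha : 0 < a) : qNum q a ≠ 0 := by
  have h1 : q⁻¹ < 1 := inv_lt_one_of_one_lt₀ hq
  have h2 : q ^ (-a) < q ^ a := zpow_lt_zpow_right₀ hq (by omega)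
  exact div_ne_zero (by linarith) (by linarith)

theorem qFact_succ (q : ℝ) (n : ℕ) : qFact q (n + 1) = qFact q n * qNum q (n + 1) := by
  simp [qFact, Finset.prod_range_succ]

theorem qFact_ne_zero {q : ℝ} (hq : 1 < q) (n : ℕ) : qFact q n ≠ 0 :=
  Finset.prod_ne_zero_iff.mpr fun _ _ => qNum_ne_zero hq (by omega)

theorem qBinom_add (q : ℝ) (n k : ℕ) :
    qBinom q ((n : ℤ) + k) k = qFact q (n + k) / (qFact q k * qFact q n) := by
  have h : ((n : ℤ) + k).toNat = n + k := by omega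
  simp [qBinom, h]

theorem qPoch_neg_ne_zero {a p : ℝ} (ha : 0 < a) (hp : 0 < p) (k : ℕ) : qPoch (-a) p k ≠ 0 :=
  Finset.prod_ne_zero_iff.mpr fun n _ => by
    have : 0 < a * p ^ n := by positivity
    linarith

theorem eval_qPochPoly (p x : ℝ) (k : ℕ) : (qPochPoly p k).eval x = qPoch x p k := by
  simp [qPochPoly, qPoch, Polynomial.eval_prod, mul_comm]

theorem qPoch_succ (a p : ℝ) (k : ℕ) : qPoch a p (k + 1) = qPoch a p k * (1 - a * p ^ k) :=
  Finset.prod_range_succ _ _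

theorem qPoch_succ' (a p : ℝ) (k : ℕ) : qPoch a p (k + 1) = (1 - a) * qPoch (a * p) p k := by
  simp only [qPoch, Finset.prod_range_succ', pow_zero, mul_one, pow_succ', mul_assoc]
  ring

/-- The `k`-th coefficient of `qJacobi q l m` in the basis `(x;q⁻²)_k`. -/
def qJacobiCoeff (q : ℝ) (l m k : ℕ) : ℝ :=
  (-1 : ℝ) ^ k * q ^ (-(k : ℤ) * ((m : ℤ) + 1)) /
      qPoch (-(q ^ (-2 * ((m : ℤ) + 1)))) (q ^ (-2 : ℤ)) k *
    (qBinom q ((l : ℤ) - (m : ℤ)) k * qBinom q ((l : ℤ) + (m : ℤ) + k) k /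
      qBinom q ((m : ℤ) + k) k)

theorem eval_qJacobi (q : ℝ) (l m : ℕ) (x : ℝ) :
    (qJacobi q l m).eval x =
      ∑ k ∈ Finset.range (l - m + 1), qJacobiCoeff q l m k * qPoch x (q ^ (-2 : ℤ)) k := by
  simp only [qJacobi, Polynomial.eval_finsetSum, Polynomial.eval_mul, Polynomial.eval_C,
    eval_qPochPoly, qJacobiCoeff]

theorem qJacobiCoeff_eq {q : ℝ} (hq : 1 < q) (m k j : ℕ) :
    qJacobiCoeff q (m + k + j) m k =
      (-1 : ℝ) ^ k * q ^ (-(k : ℤ) * ((m : ℤ) + 1)) /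
          qPoch (-(q ^ (-2 * ((m : ℤ) + 1)))) (q ^ (-2 : ℤ)) k *
        (qFact q (k + j) * qFact q (m + k + j + m + k) * qFact q m /
          (qFact q j * qFact q (m + k + j + m) * qFact q (m + k) * qFact q k)) := by
  have h1 : ((m + k + j : ℕ) : ℤ) - (m : ℤ) = (j : ℤ) + k := by push_cast; ring
  have h2 : ((m + k + j : ℕ) : ℤ) + (m : ℤ) + k = ((m + k + j + m : ℕ) : ℤ) + k := by
    push_cast; ring
  have := qFact_ne_zero hq
  rw [qJacobiCoeff, h1, h2, qBinom_add, qBinom_add, qBinom_add, add_comm j k]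
  congr 1
  field_simp

/-- The two-term recurrence of the coefficients, in terms of `q`-numbers. -/
theorem qJacobiCoeff_succ {q : ℝ} (hq : 1 < q) (m k j : ℕ) :
    qJacobiCoeff q (m + k + j + 1) m (k + 1) *
        ((1 + q ^ (-2 * ((m : ℤ) + 1)) * (q ^ (-2 : ℤ)) ^ k) *
          (qNum q (m + k + 1) * qNum q (k + 1))) =
      -(qJacobiCoeff q (m + k + j + 1) m k * (q ^ (-((m : ℤ) + 1)) *
        (qNum q (j + 1) * qNum q (2 * m + 2 * k + j + 2)))) := by
  have hq0 : 0 < q := by linarith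
  have hf := qFact_ne_zero hq
  have hP := qPoch_neg_ne_zero (a := q ^ (-2 * ((m : ℤ) + 1))) (p := q ^ (-2 : ℤ))
    (by positivity) (by positivity) k
  have hc : 1 + q ^ (-2 * ((m : ℤ) + 1)) * (q ^ (-2 : ℤ)) ^ k ≠ 0 := by positivity
  have n1 : qNum q (m + k + 1) ≠ 0 := qNum_ne_zero hq (by omega)
  have n2 : qNum q (k + 1) ≠ 0 := qNum_ne_zero hq (by omega)
  have n3 : qNum q (j + 1) ≠ 0 := qNum_ne_zero hq (by omega)
  have e1 := qJacobiCoeff_eq hq m (k + 1) j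
  have e2 := qJacobiCoeff_eq hq m k (j + 1)
  rw [show m + (k + 1) + j = m + k + j + 1 by ring] at e1
  rw [show m + k + (j + 1) = m + k + j + 1 by ring] at e2
  have f1 := qFact_succ q (m + k + j + 1 + m + k)
  have f2 := qFact_succ q (m + k)
  have f3 := qFact_succ q k
  have f4 := qFact_succ q j
  rw [show (((m + k + j + 1 + m + k : ℕ) : ℤ) + 1) = 2 * m + 2 * k + j + 2 by
    push_cast; ring] at f1
  rw [Nat.cast_add] at f2
  have hz : q ^ (-((k + 1 : ℕ) : ℤ) * ((m : ℤ) + 1)) =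
      q ^ (-(k : ℤ) * ((m : ℤ) + 1)) * q ^ (-((m : ℤ) + 1)) := by
    rw [← zpow_add₀ hq0.ne']; congr 1; push_cast; ring
  rw [e1, e2, hz, qPoch_succ, show m + (k + 1) = m + k + 1 by ring,
    show m + k + j + 1 + m + (k + 1) = m + k + j + 1 + m + k + 1 by ring, f1, f2, f3, f4,
    show k + 1 + j = k + (j + 1) by ring, neg_mul (q ^ (-2 * ((m : ℤ) + 1))), sub_neg_eq_add]
  generalize q ^ (-2 * ((m : ℤ) + 1)) * (q ^ (-2 : ℤ)) ^ k = c at *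
  generalize qPoch (-(q ^ (-2 * ((m : ℤ) + 1)))) (q ^ (-2 : ℤ)) k = P at *
  have := hf j
  have := hf k
  have := hf (m + k)
  have := hf (m + k + j + 1 + m)
  rw [pow_succ]
  field_simp

/-- The recurrence of the coefficients in terms of `p = q⁻²`. -/
theorem qJacobiCoeff_recurrence {q : ℝ} (hq : 1 < q) {l m k : ℕ} (h : m + k < l) :
    qJacobiCoeff q l m (k + 1) * ((1 - (q ^ (-2 : ℤ)) ^ (k + 1)) *
        (((q ^ (-2 : ℤ)) ^ (k + 1))⁻¹ - q ^ (-2 * (2 * (m : ℤ) + 1)) * (q ^ (-2 : ℤ)) ^ k)) =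
      -(qJacobiCoeff q l m k *
        (q ^ (-1 - 2 * (m : ℤ)) * (q ^ (2 * (l : ℤ) + 1) + q ^ (-2 * (l : ℤ) - 1)) -
          q ^ (-2 * (2 * (m : ℤ) + 1)) * (q ^ (-2 : ℤ)) ^ k - ((q ^ (-2 : ℤ)) ^ k)⁻¹)) := by
  obtain ⟨j, rfl⟩ := Nat.exists_eq_add_of_lt h
  have hq0 : q ≠ 0 := by linarith
  have hd : q - q⁻¹ ≠ 0 := by
    have : q⁻¹ < 1 := inv_lt_one_of_one_lt₀ hq
    linarith
  have key := congrArg (· * ((q - q⁻¹) ^ 2 * q ^ (-(m : ℤ)))) (qJacobiCoeff_succ hq m k j)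
  simp only [qNum] at key
  have hz : ∀ a b : ℤ, q ^ (a + b) = q ^ a * q ^ b := zpow_add₀ hq0
  generalize qJacobiCoeff q (m + k + j + 1) m (k + 1) = a' at *
  generalize qJacobiCoeff q (m + k + j + 1) m k = a at *
  generalize q - q⁻¹ = d at *
  have hp : q ^ (-2 : ℤ) = (q ^ 2)⁻¹ := by
    rw [zpow_neg]; rfl
  have L : a' * ((1 - (q ^ (-2 : ℤ)) ^ (k + 1)) *
        (((q ^ (-2 : ℤ)) ^ (k + 1))⁻¹ - q ^ (-2 * (2 * (m : ℤ) + 1)) * (q ^ (-2 : ℤ)) ^ k)) =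
      a' * ((1 + q ^ (-2 * ((m : ℤ) + 1)) * (q ^ (-2 : ℤ)) ^ k) *
        ((q ^ ((m : ℤ) + k + 1) - q ^ (-((m : ℤ) + k + 1))) / d *
          ((q ^ ((k : ℤ) + 1) - q ^ (-((k : ℤ) + 1))) / d))) *
        (d ^ 2 * q ^ (-(m : ℤ))) := by
    simp only [hp, neg_mul, zpow_neg, hz, zpow_natCast, zpow_one, two_mul, mul_add, mul_one,
      pow_succ, inv_pow, neg_add]
    field_simp
    ring
  have R : a * (q ^ (-1 - 2 * (m : ℤ)) * (q ^ (2 * ((m + k + j + 1 : ℕ) : ℤ) + 1) +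
            q ^ (-2 * ((m + k + j + 1 : ℕ) : ℤ) - 1)) -
          q ^ (-2 * (2 * (m : ℤ) + 1)) * (q ^ (-2 : ℤ)) ^ k - ((q ^ (-2 : ℤ)) ^ k)⁻¹) =
      a * (q ^ (-((m : ℤ) + 1)) *
        ((q ^ ((j : ℤ) + 1) - q ^ (-((j : ℤ) + 1))) / d *
          ((q ^ (2 * (m : ℤ) + 2 * k + j + 2) - q ^ (-(2 * (m : ℤ) + 2 * k + j + 2))) /
            d))) * (d ^ 2 * q ^ (-(m : ℤ))) := by
    simp only [hp, neg_mul, zpow_neg, hz, zpow_sub₀ hq0, zpow_natCast, two_mul, mul_add,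
      mul_one, inv_pow, neg_add, Nat.cast_add, Nat.cast_one, zpow_ofNat]
    field_simp
    ring
  rw [L, R, key]
  ring

/-- Action of the difference operator on `(x;p)_{k+1}`. -/
theorem qPoch_difference {p : ℝ} (hp : p ≠ 0) (A C x : ℝ) (k : ℕ) :
    (C * x ^ 2 - A * (1 + p)) * qPoch x p (k + 1) - A * (x ^ 2 - 1) * qPoch (x * p) p (k + 1) -
        (x ^ 2 - A * p) * qPoch (x * p⁻¹) p (k + 1) =
      x ^ 2 * ((C - A * p ^ (k + 1) - (p ^ (k + 1))⁻¹) * qPoch x p (k + 1) +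
        (1 - p ^ (k + 1)) * ((p ^ (k + 1))⁻¹ - A * p ^ k) * qPoch x p k) := by
  have h1 : (x ^ 2 - 1) * qPoch (x * p) p (k + 1) = -(x + 1) * qPoch x p (k + 2) := by
    rw [qPoch_succ' x p (k + 1)]; ring
  have h2 : qPoch (x * p⁻¹) p (k + 1) = (1 - x * p⁻¹) * qPoch x p k := by
    rw [qPoch_succ', inv_mul_cancel_right₀ hp]
  rw [mul_assoc A, h1, h2, qPoch_succ x p (k + 1), qPoch_succ x p k]
  field_simp
  ring

/-- The difference operator telescopes on partial sums with a suitable two-term recurrence. -/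
theorem sum_qPoch_difference {p : ℝ} (hp : p ≠ 0) (A C x : ℝ) (a : ℕ → ℝ) (n : ℕ)
    (ha : ∀ k < n, a (k + 1) * ((1 - p ^ (k + 1)) * ((p ^ (k + 1))⁻¹ - A * p ^ k)) =
      -(a k * (C - A * p ^ k - (p ^ k)⁻¹))) :
    (C * x ^ 2 - A * (1 + p)) * ∑ k ∈ Finset.range (n + 1), a k * qPoch x p k -
        A * (x ^ 2 - 1) * ∑ k ∈ Finset.range (n + 1), a k * qPoch (x * p) p k -
        (x ^ 2 - A * p) * ∑ k ∈ Finset.range (n + 1), a k * qPoch (x * p⁻¹) p k =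
      x ^ 2 * (a n * (C - A * p ^ n - (p ^ n)⁻¹)) * qPoch x p n := by
  induction n with
  | zero => simp [qPoch]; ring
  | succ n ih =>
    have ih := ih fun k hk => ha k (by omega)
    have h := ha n (by omega)
    have hd := qPoch_difference hp A C x n
    simp only [Finset.sum_range_succ _ (n + 1)]
    linear_combination ih + a (n + 1) * hd + x ^ 2 * qPoch x p n * h

/-- the q-difference equation
(q^{−1−2m}(q^{2l+1}+q^{−2l−1})x² − q^{−4(m+1)}(q²+1)) P^m_l(x)
 = q^{−2(2m+1)}(x²−1) P^m_l(xq⁻²) + (x² − q^{−4(m+1)}) P^m_l(xq²). -/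
theorem stmt12 (q : ℝ) (hq : 1 < q) (l m : ℕ) (hml : m ≤ l) :
    ∀ x : ℝ,
      (q ^ (-1 - 2 * (m : ℤ)) * (q ^ (2 * (l : ℤ) + 1) + q ^ (-2 * (l : ℤ) - 1)) * x ^ 2 -
          q ^ (-4 * ((m : ℤ) + 1)) * (q ^ 2 + 1)) * (qJacobi q l m).eval x =
        q ^ (-2 * (2 * (m : ℤ) + 1)) * (x ^ 2 - 1) *
          (qJacobi q l m).eval (x * q ^ (-2 : ℤ)) +
        (x ^ 2 - q ^ (-4 * ((m : ℤ) + 1))) * (qJacobi q l m).eval (x * q ^ 2) := by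
  intro x
  have hq0 : q ≠ 0 := by linarith
  have hp : q ^ (-2 : ℤ) ≠ 0 := zpow_ne_zero _ hq0
  have hinv : (q ^ (-2 : ℤ))⁻¹ = q ^ 2 := by rw [← zpow_neg]; rfl
  have h := sum_qPoch_difference hp (q ^ (-2 * (2 * (m : ℤ) + 1)))
    (q ^ (-1 - 2 * (m : ℤ)) * (q ^ (2 * (l : ℤ) + 1) + q ^ (-2 * (l : ℤ) - 1))) x
    (qJacobiCoeff q l m) (l - m) fun k hk => qJacobiCoeff_recurrence hq (by omega)
  have hB : q ^ (-2 * (2 * (m : ℤ) + 1)) * q ^ (-2 : ℤ) = q ^ (-4 * ((m : ℤ) + 1)) := by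
    rw [← zpow_add₀ hq0]; congr 1; ring
  have hc : q ^ (-2 * (2 * (m : ℤ) + 1)) * (1 + q ^ (-2 : ℤ)) =
      q ^ (-4 * ((m : ℤ) + 1)) * (q ^ 2 + 1) := by
    rw [← hB, ← hinv]; field_simp
  have hα : q ^ (-1 - 2 * (m : ℤ)) * (q ^ (2 * (l : ℤ) + 1) + q ^ (-2 * (l : ℤ) - 1)) -
      q ^ (-2 * (2 * (m : ℤ) + 1)) * (q ^ (-2 : ℤ)) ^ (l - m) -
        ((q ^ (-2 : ℤ)) ^ (l - m))⁻¹ = 0 := by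
    rw [← zpow_natCast, ← zpow_mul, ← zpow_neg, mul_add, ← zpow_add₀ hq0, ← zpow_add₀ hq0,
      ← zpow_add₀ hq0, Nat.cast_sub hml]
    ring_nf
  rw [hα, hinv, hB, hc] at h
  simp only [← eval_qJacobi] at h
  linear_combination h
end
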